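/- Let n be a positive even integer and let p > n + 1 be a prime. Then the sum in ℤ/pℤ of (-1)^{i_1}/(i_1 ⋯ i_n) over all n-tuples of integers 0 < i_1 < i_2 < ⋯ < i_n < p with i_1 ≡ 0 (mod 3) equals twice the sum in ℤ/pℤ of 1/(i_1 ⋯ i_n) over all n-tuples of integers 0 < i_1 < i_2 < ⋯ < i_n < p with i_1 ≡ 2, 3, or 4 (mod 6). -/

import Mathlib

open Polynomial Finset

/-- The elementary symmetric sum of degree `n` of the inverses of the integers strictly between
`m` and `p`, as an element of `ℤ/pℤ`. -/
noncomputable def invEsymm (p n m : ℕ) : ZMod p :=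
  (∏ i ∈ Ioo m p, (1 + C ((i : ZMod p)⁻¹) * X)).coeff n

lemma invEsymm_zero (p m : ℕ) : invEsymm p 0 m = 1 := by
  simp [invEsymm, coeff_zero_eq_eval_zero, eval_prod]

lemma invEsymm_succ_of_le {p m : ℕ} (n : ℕ) (h : p ≤ m + 1) : invEsymm p (n + 1) m = 0 := by
  have : Ioo m p = ∅ := by ext; simp; omega
  simp [invEsymm, this, coeff_one]

lemma Ioo_eq_insert_succ {p m : ℕ} (h : m + 1 < p) :
    Ioo m p = insert (m + 1) (Ioo (m + 1) p) := by
  ext; simp; omega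

lemma invEsymm_succ_of_lt {p m : ℕ} (n : ℕ) (h : m + 1 < p) :
    invEsymm p (n + 1) m =
      invEsymm p (n + 1) (m + 1) + ((m + 1 : ℕ) : ZMod p)⁻¹ * invEsymm p n (m + 1) := by
  rw [invEsymm, Ioo_eq_insert_succ h, prod_insert (by simp), add_mul, one_mul, coeff_add,
    mul_assoc, coeff_C_mul, coeff_X_mul]
  rfl

lemma invEsymm_succ (p n m : ℕ) :
    invEsymm p (n + 1) m = ∑ i ∈ Ioo m p, (i : ZMod p)⁻¹ * invEsymm p n i := by
  rcases le_or_gt p (m + 1) with h | h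
  · rw [invEsymm_succ_of_le n h, show Ioo m p = ∅ by ext; simp; omega, sum_empty]
  · rw [invEsymm_succ_of_lt n h, invEsymm_succ p n (m + 1), Ioo_eq_insert_succ h,
      sum_insert (by simp), add_comm]
termination_by p - m

/-- A sum over increasing tuples, weighted by a function of the first entry, splits according to
the value of the first entry. -/
lemma sum_strictMono_succ {R : Type*} [CommSemiring R] (w g : ℕ → R) (n m p : ℕ) :
    ∑ f ∈ (Fintype.piFinset fun _ : Fin (n + 1) => Ioo m p).filter
        (fun f => ∀ i j : Fin (n + 1), i < j → f i < f j), g (f 0) * ∏ k, w (f k) =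
      ∑ i ∈ Ioo m p, g i * (w i * ∑ f ∈ (Fintype.piFinset fun _ : Fin n => Ioo i p).filter
        (fun f => ∀ i j : Fin n, i < j → f i < f j), ∏ k, w (f k)) := by
  simp_rw [mul_sum]
  rw [sum_sigma']
  refine sum_nbij' (fun f => ⟨f 0, Fin.tail f⟩) (fun x => Fin.cons x.1 x.2) ?_ ?_ ?_ ?_ ?_
  · intro f hf
    simp only [mem_filter, Fintype.mem_piFinset, mem_Ioo, mem_sigma, Fin.tail] at hf ⊢
    exact ⟨hf.1 0, fun k => ⟨hf.2 _ _ (Fin.succ_pos k), (hf.1 _).2⟩,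
      fun i j hij => hf.2 _ _ (Fin.succ_lt_succ_iff.2 hij)⟩
  · rintro ⟨i, f⟩ hf
    simp only [mem_filter, Fintype.mem_piFinset, mem_Ioo, mem_sigma] at hf ⊢
    obtain ⟨hi, hf, hmono⟩ := hf
    refine ⟨Fin.cases (by simpa using hi) fun k => ?_, Fin.cases (fun j => ?_) fun i j => ?_⟩
    · simpa using ⟨hi.1.trans (hf k).1, (hf k).2⟩
    · refine Fin.cases (by simp) (fun j _ => ?_) j
      simpa using (hf j).1
    · refine Fin.cases (by simp) (fun j hij => ?_) j
      simpa using hmono _ _ (Fin.succ_lt_succ_iff.1 hij)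
  · intro f _
    exact Fin.cons_self_tail f
  · rintro ⟨i, f⟩ _
    simp
  · intro f _
    simp [Fin.prod_univ_succ, Fin.tail]

lemma sum_strictMono_eq_invEsymm (p n m : ℕ) :
    ∑ f ∈ (Fintype.piFinset fun _ : Fin n => Ioo m p).filter
        (fun f => ∀ i j : Fin n, i < j → f i < f j), ∏ k, ((f k : ZMod p))⁻¹ =
      invEsymm p n m := by
  induction n generalizing m with
  | zero => simp [invEsymm_zero, filter_true_of_mem]
  | succ n ih =>
    have := sum_strictMono_succ (fun i => (i : ZMod p)⁻¹) (fun _ => 1) n m p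
    simp only [one_mul] at this
    rw [this, invEsymm_succ]
    simp_rw [ih]

/-- The polynomial `∑ X ^ i₁ / (i₁ ⋯ iₙ)` over `0 < i₁ < ⋯ < iₙ < p`, extended by `X ^ p - X` at
`n = 0`. -/
noncomputable def truncPolylog (p : ℕ) : ℕ → (ZMod p)[X]
  | 0 => X ^ p - X
  | n + 1 => ∑ i ∈ Ioo 0 p, C ((i : ZMod p)⁻¹ * invEsymm p n i) * X ^ i

lemma sum_Ico_mul_pow_sub_pow_succ {R : Type*} [CommRing R] (a : ℕ → R) (x : R) (m : ℕ) :
    ∑ i ∈ Ico 1 (m + 1), a i * (x ^ i - x ^ (i + 1)) =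
      a 0 * x - a m * x ^ (m + 1) - ∑ i ∈ Ico 1 (m + 1), (a (i - 1) - a i) * x ^ i := by
  induction m with
  | zero => simp
  | succ m ih =>
    rw [sum_Ico_succ_top (Nat.le_add_left 1 m), sum_Ico_succ_top (Nat.le_add_left 1 m), ih]
    simp only [Nat.add_sub_cancel]
    ring

lemma Ioo_zero_eq_Ico_one (p : ℕ) : Ioo 0 p = Ico 1 p := by
  ext; simp; omega

section Prime

variable {p : ℕ} [Fact p.Prime]

lemma natCast_ne_zero_of_mem_Ioo {i : ℕ} (hi : i ∈ Ioo 0 p) : (i : ZMod p) ≠ 0 := by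
  rw [mem_Ioo] at hi
  rw [Ne, ZMod.natCast_eq_zero_iff]
  exact Nat.not_dvd_of_pos_of_lt hi.1 hi.2

lemma prod_one_add_inv_mul_X :
    ∏ i ∈ Ioo 0 p, (1 + C ((i : ZMod p)⁻¹) * X) = 1 - X ^ (p - 1) := by
  have hp : p.Prime := Fact.out
  have h1 : (∏ i ∈ Ioo 0 p, (1 + C ((i : ZMod p)⁻¹) * X)).natDegree ≤ p - 1 := by
    refine (natDegree_prod_le _ _).trans ((sum_le_card_nsmul _ _ 1 fun i _ => ?_).trans ?_)
    · compute_degree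
    · simp
  have h2 : (1 - X ^ (p - 1) : (ZMod p)[X]).natDegree ≤ p - 1 := by compute_degree
  have hpos := hp.one_lt
  refine eq_of_natDegree_lt_card_of_eval_eq' _ _ univ (fun a _ => ?_) ?_
  · by_cases ha : a = 0
    · simp [ha, eval_prod, Nat.sub_ne_zero_of_lt hp.one_lt]
    · rw [eval_prod]
      have hmem : (-a).val ∈ Ioo 0 p :=
        mem_Ioo.2 ⟨Nat.pos_of_ne_zero (by simpa [ZMod.val_eq_zero] using ha), ZMod.val_lt _⟩
      rw [prod_eq_zero hmem]
      · simp [ZMod.pow_card_sub_one_eq_one ha]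
      · simp [inv_neg, ha]
  · rw [card_univ, ZMod.card]
    omega

lemma invEsymm_zero_right {n : ℕ} (hn : 0 < n) (hnp : n + 1 < p) : invEsymm p n 0 = 0 := by
  rw [invEsymm, prod_one_add_inv_mul_X, coeff_sub, coeff_one, coeff_X_pow,
    if_neg (by omega), if_neg (by omega), sub_zero]

lemma X_mul_derivative_truncPolylog_succ (n : ℕ) :
    X * derivative (truncPolylog p (n + 1)) = ∑ i ∈ Ioo 0 p, C (invEsymm p n i) * X ^ i := by
  rw [truncPolylog, derivative_sum, mul_sum]
  refine sum_congr rfl fun i hi => ?_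
  have h0 := natCast_ne_zero_of_mem_Ioo hi
  obtain ⟨j, rfl⟩ : ∃ j, i = j + 1 := ⟨i - 1, by rw [mem_Ioo] at hi; omega⟩
  rw [derivative_C_mul_X_pow, mul_comm, Nat.add_sub_cancel, mul_assoc, ← pow_succ,
    mul_right_comm, inv_mul_cancel₀ h0, one_mul]

lemma X_mul_one_sub_X_mul_derivative_truncPolylog {n : ℕ} (hnp : n + 1 < p) :
    X * (1 - X) * derivative (truncPolylog p (n + 1)) = -truncPolylog p n := by
  obtain ⟨q, rfl⟩ : ∃ q, p = q + 1 := ⟨p - 1, by omega⟩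
  have key := sum_Ico_mul_pow_sub_pow_succ (fun i => C (invEsymm (q + 1) n i)) X q
  rw [mul_right_comm, X_mul_derivative_truncPolylog_succ, sum_mul, Ioo_zero_eq_Ico_one]
  have hl : ∀ i ∈ Ico 1 (q + 1), C (invEsymm (q + 1) n i) * X ^ i * (1 - X) =
      C (invEsymm (q + 1) n i) * (X ^ i - X ^ (i + 1)) := fun i _ => by ring
  rw [sum_congr rfl hl, key]
  cases n with
  | zero => simp [invEsymm_zero, truncPolylog]
  | succ n =>
    rw [invEsymm_zero_right n.succ_pos hnp, invEsymm_succ_of_le n le_rfl, truncPolylog,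
      Ioo_zero_eq_Ico_one]
    simp only [C_0, zero_mul, sub_zero, zero_sub, neg_inj]
    refine sum_congr rfl fun i hi => ?_
    rw [mem_Ico] at hi
    obtain ⟨j, rfl⟩ : ∃ j, i = j + 1 := ⟨i - 1, by omega⟩
    rw [Nat.add_sub_cancel, invEsymm_succ_of_lt n hi.2, ← C_sub, add_sub_cancel_left]

lemma natDegree_truncPolylog_succ_lt (n : ℕ) : (truncPolylog p (n + 1)).natDegree < p := by
  have hp : p.Prime := Fact.out
  refine lt_of_le_of_lt (natDegree_sum_le_of_forall_le (n := p - 1) _ _ fun i hi => ?_)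
    (Nat.sub_lt hp.pos one_pos)
  rw [mem_Ioo] at hi
  exact (natDegree_C_mul_X_pow_le _ _).trans (by omega)

lemma eq_C_of_derivative_eq_zero_of_natDegree_lt {f : (ZMod p)[X]} (hf : derivative f = 0)
    (hdeg : f.natDegree < p) : f = C (f.coeff 0) := by
  ext k
  rw [coeff_C]
  split_ifs with hk
  · rw [hk]
  · rcases lt_or_ge k p with hkp | hkp
    · obtain ⟨j, rfl⟩ := Nat.exists_eq_succ_of_ne_zero hk
      have := congrArg (fun g => coeff g j) hf
      simp only [coeff_derivative, coeff_zero, mul_eq_zero] at this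
      refine this.resolve_right ?_
      exact_mod_cast natCast_ne_zero_of_mem_Ioo (mem_Ioo.2 ⟨Nat.succ_pos j, hkp⟩)
    · exact coeff_eq_zero_of_natDegree_lt (hdeg.trans_le hkp)

theorem truncPolylog_comp_one_sub_X {n : ℕ} (hnp : n + 1 < p) :
    (truncPolylog p n).comp (1 - X) = (-1) ^ (n + 1) * truncPolylog p n := by
  induction n with
  | zero =>
    simp only [truncPolylog, sub_comp, pow_comp, X_comp, sub_pow_char, one_pow]
    ring
  | succ n ih =>
    have hd := X_mul_one_sub_X_mul_derivative_truncPolylog (p := p) (n := n) (by omega)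
    have hd' := congrArg (fun f => f.comp (1 - X)) hd
    simp only [mul_comp, sub_comp, X_comp, one_comp, neg_comp, ih (by omega)] at hd'
    rw [← sub_eq_zero]
    set f := (truncPolylog p (n + 1)).comp (1 - X) - (-1) ^ (n + 1 + 1) * truncPolylog p (n + 1)
      with hf
    have hpow : ((-1) ^ (n + 1 + 1) : (ZMod p)[X]) = C ((-1) ^ (n + 1 + 1)) := by simp
    have hne : (X * (1 - X) : (ZMod p)[X]) ≠ 0 := by
      refine mul_ne_zero X_ne_zero fun h => ?_
      simpa using congrArg (eval 0) h
    have hder : derivative f = 0 := by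
      refine (mul_eq_zero.1 ?_).resolve_left hne
      rw [hf, hpow, derivative_sub, derivative_comp, derivative_C_mul, ← hpow]
      simp only [derivative_sub, derivative_one, derivative_X]
      linear_combination -hd' - (-1) ^ (n + 1 + 1) * hd
    have hdeg : f.natDegree < p := by
      have hlt := natDegree_truncPolylog_succ_lt (p := p) n
      refine (natDegree_sub_le _ _).trans_lt (max_lt ?_ ?_)
      · refine natDegree_comp_le.trans_lt (lt_of_le_of_lt ?_ hlt)
        have h1X : (1 - X : (ZMod p)[X]).natDegree ≤ 1 := by compute_degree
        exact (Nat.mul_le_mul_left _ h1X).trans_eq (mul_one _)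
      · rw [hpow]
        exact (natDegree_C_mul_le _ _).trans_lt hlt
    rw [eq_C_of_derivative_eq_zero_of_natDegree_lt hder hdeg, coeff_zero_eq_eval_zero, hf]
    have h1 : eval 1 (truncPolylog p (n + 1)) = 0 := by
      rw [← invEsymm_zero_right n.succ_pos hnp, invEsymm_succ, truncPolylog]
      simp [eval_finsetSum]
    have h0 : eval 0 (truncPolylog p (n + 1)) = 0 := by
      rw [truncPolylog, eval_finsetSum]
      refine sum_eq_zero fun i hi => ?_
      rw [mem_Ioo] at hi
      simp [hi.1.ne']
    simp [eval_comp, h0, h1]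

end Prime

lemma pow_add_one_sub_pow {K : Type*} [CommRing K] {u : K} (hu : u ^ 2 - u + 1 = 0) (i : ℕ) :
    u ^ i + (1 - u) ^ i - 1 = (if i % 3 = 0 then (-1) ^ i else 0) -
      2 * (if i % 6 = 2 ∨ i % 6 = 3 ∨ i % 6 = 4 then 1 else 0) := by
  have h3 : u ^ 3 = -1 := by linear_combination (u + 1) * hu
  have h3' : (1 - u) ^ 3 = -1 := by linear_combination (2 - u) * hu
  have h6 : u ^ 6 = 1 := by linear_combination (u ^ 3 - 1) * h3
  have h6' : (1 - u) ^ 6 = 1 := by linear_combination ((1 - u) ^ 3 - 1) * h3'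
  have hm : i % 3 = i % 6 % 3 := by omega
  have hlt : i % 6 < 6 := Nat.mod_lt _ (by norm_num)
  rw [pow_eq_pow_mod i h6, pow_eq_pow_mod i h6',
    pow_eq_pow_mod i (show (-1 : K) ^ 6 = 1 by norm_num), hm]
  generalize i % 6 = r at hlt
  interval_cases r <;> norm_num
  · linear_combination 2 * hu
  · linear_combination h3 + h3'
  · linear_combination u * h3 + (1 - u) * h3'
  · linear_combination u ^ 2 * h3 + (1 - u) ^ 2 * h3' - 2 * hu

/-- Let `n` be a positive even integer and `p > n + 1` a prime. Then the sum in `ℤ/pℤ` of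
`(-1)^{i₁}/(i₁⋯iₙ)` over strictly increasing `n`-tuples `0 < i₁ < ⋯ < iₙ < p` with
`3 ∣ i₁` equals twice the sum of `1/(i₁⋯iₙ)` over such tuples with
`i₁ ≡ 2, 3, 4 (mod 6)`. -/
theorem curious_congruence_even (n p : ℕ) (hn : 0 < n) (heven : Even n)
    (hp : p.Prime) (hnp : n + 1 < p) :
    ∑ f ∈ (Fintype.piFinset fun _ : Fin n => Finset.Ioo 0 p).filter
        (fun f => (∀ i j : Fin n, i < j → f i < f j) ∧ f ⟨0, hn⟩ % 3 = 0),
      (-1 : ZMod p) ^ (f ⟨0, hn⟩) * ∏ k : Fin n, ((f k : ZMod p))⁻¹ =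
    2 * ∑ f ∈ (Fintype.piFinset fun _ : Fin n => Finset.Ioo 0 p).filter
        (fun f => (∀ i j : Fin n, i < j → f i < f j) ∧
          (f ⟨0, hn⟩ % 6 = 2 ∨ f ⟨0, hn⟩ % 6 = 3 ∨ f ⟨0, hn⟩ % 6 = 4)),
      ∏ k : Fin n, ((f k : ZMod p))⁻¹ := by
  have : Fact p.Prime := ⟨hp⟩
  obtain ⟨n, rfl⟩ := Nat.exists_eq_succ_of_ne_zero hn.ne'
  have hl := sum_strictMono_succ (fun i => (i : ZMod p)⁻¹)
    (fun i => if i % 3 = 0 then (-1) ^ i else 0) n 0 p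
  have hr := sum_strictMono_succ (fun i => (i : ZMod p)⁻¹)
    (fun i => if i % 6 = 2 ∨ i % 6 = 3 ∨ i % 6 = 4 then 1 else 0) n 0 p
  simp only [ite_mul, zero_mul, one_mul, ← sum_filter, filter_filter,
    sum_strictMono_eq_invEsymm] at hl hr
  refine hl.trans (Eq.trans ?_ (congrArg (2 * ·) hr).symm)
  rw [← sub_eq_zero]
  obtain ⟨u, hu⟩ := IsAlgClosed.exists_aeval_eq_zero (AlgebraicClosure (ZMod p))
    (X ^ 2 - X + 1 : (ZMod p)[X]) (by
      rw [show (X ^ 2 - X + 1 : (ZMod p)[X]).degree = 2 by compute_degree!]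
      norm_num)
  replace hu : u ^ 2 - u + 1 = 0 := by simpa using hu
  have hsymm := congrArg (aeval u) (truncPolylog_comp_one_sub_X hnp)
  have h1 := invEsymm_zero_right hn hnp
  rw [invEsymm_succ] at h1
  replace h1 := congrArg (algebraMap (ZMod p) (AlgebraicClosure (ZMod p))) h1
  rw [heven.add_one.neg_one_pow, aeval_comp, neg_one_mul, map_neg, truncPolylog] at hsymm
  simp only [map_sub, map_one, aeval_X, map_sum, map_mul, aeval_C, map_pow, map_zero]
    at hsymm h1
  apply (algebraMap (ZMod p) (AlgebraicClosure (ZMod p))).injective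
  rw [sum_filter, sum_filter, map_zero]
  simp only [map_sub, map_sum, map_mul, map_ofNat, apply_ite (algebraMap (ZMod p) _), map_pow,
    map_neg, map_one, map_zero]
  rw [mul_sum, ← sum_sub_distrib]
  have key : ∀ i ∈ Ioo 0 p, (_ : AlgebraicClosure (ZMod p)) = _ := fun i _ =>
    congrArg (· * (algebraMap (ZMod p) (AlgebraicClosure (ZMod p)) (i : ZMod p)⁻¹ *
      algebraMap (ZMod p) (AlgebraicClosure (ZMod p)) (invEsymm p n i))) (pow_add_one_sub_pow hu i)
  have hsum := sum_congr rfl key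
  simp only [sub_mul, add_mul, ite_mul, mul_ite, zero_mul, mul_zero, mul_one, one_mul,
    sum_sub_distrib, sum_add_distrib] at hsum ⊢
  simp only [mul_comm] at hsum hsymm h1 ⊢
  linear_combination -hsum + hsymm - h1
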